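/- arXiv:2409.01370 — 4 statements merged into one kernel-verified Lean document; each statement's English description precedes it below -/
import Mathlib

section
/- Let E and F be reflexive relations on types X and Y, and let f : X → Y be a digraph morphism, i.e., x E x' implies f(x) F f(x') for all x, x'. Then for every σ ∈ dVR(X,E), the image f(σ) (as a finite set, with duplicates identified) belongs to dVR(Y,F). Hence dVR is functorial on digraph morphisms. -/
/-- The directed Vietoris–Rips complex of a digraph `(X, E)`. -/
def dVR {X : Type*} [DecidableEq X] (E : X → X → Prop) : Set (Finset X) :=
  {σ | σ.Nonempty ∧ ∃ l : List X, l.Nodup ∧ l.toFinset = σ ∧ l.Pairwise E}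

/-- A digraph morphism `f : (X,E) → (Y,F)` sends simplices of `dVR (X,E)` to
simplices of `dVR (Y,F)` (taking images as finite sets, identifying duplicates);
hence `dVR` is functorial on digraph morphisms. -/
theorem dVR_functorial {X Y : Type*} [DecidableEq X] [DecidableEq Y]
    (E : X → X → Prop) (F : Y → Y → Prop) (hE : Reflexive E) (hF : Reflexive F)
    (f : X → Y) (hf : ∀ x x' : X, E x x' → F (f x) (f x')) :
    ∀ σ ∈ dVR E, σ.image f ∈ dVR F := by
  rintro _ ⟨hne, l, -, rfl, hl⟩
  refine ⟨hne.image f, (l.map f).dedup, List.nodup_dedup _, ?_, ?_⟩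
  · ext y
    simp
  · exact (hl.map f hf).sublist (List.dedup_sublist _)
end

section
/- In the pushout setup along a closed inclusion, the following hold: (1) for every B ⊆ Y, e(j(B)) = j(d(B)); (2) for every B ⊆ X∖A, e(g(B)) = g(c(B)); (3) for every B ⊆ Z, e(B) = j(d(j⁻¹(B))) ∪ g(c(B_X)), where B_X = {x ∈ X∖A | g(x) ∈ B}; (4) j is a closed inclusion: j is injective and for every K ⊆ Y with d(K) = K, one has e(j(K)) = j(K). -/
/-- A Čech closure operator on `X`. -/
def IsCechClosure {X : Type*} (c : Set X → Set X) : Prop :=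
  c ∅ = ∅ ∧ (∀ A : Set X, A ⊆ c A) ∧ (∀ A B : Set X, c (A ∪ B) = c A ∪ c B)

theorem IsCechClosure.mono {X : Type*} {c : Set X → Set X} (hc : IsCechClosure c) :
    Monotone c := by
  intro S T h
  rw [← Set.union_eq_self_of_subset_left h, hc.2.2]
  exact Set.subset_union_left

/-- Pushout of closure spaces along a closed inclusion `A ↪ X` and a map `f : A → Y`,
modelled on the set `Z = Y ⊕ (X ∖ A)` with `j` the left inclusion, `g` the induced map
`X → Z`, and pushout closure `e(B) = j(d(j⁻¹ B)) ∪ g(c(g⁻¹ B))`. Conclusions: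
(1) `e(j(B)) = j(d(B))`; (2) `e(g(B)) = g(c(B))` for `B ⊆ X∖A`;
(3) `e(B) = j(d(j⁻¹ B)) ∪ g(c(B_X))` with `B_X = {x ∈ X∖A | g x ∈ B}`;
(4) `j` is a closed inclusion. -/
theorem pushout_closure_along_closed_inclusion {X Y : Type*}
    (c : Set X → Set X) (d : Set Y → Set Y)
    (hc : IsCechClosure c) (hd : IsCechClosure d)
    (A : Set X) (hA : c A = A) (f : X → Y)
    (hf : ∀ S : Set X, S ⊆ A → f '' (c S) ⊆ d (f '' S))
    (j : Y → Y ⊕ {x : X // x ∉ A}) (hj : j = Sum.inl)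
    (g : X → Y ⊕ {x : X // x ∉ A})
    (hg₁ : ∀ x : X, x ∈ A → g x = Sum.inl (f x))
    (hg₂ : ∀ (x : X) (h : x ∉ A), g x = Sum.inr ⟨x, h⟩)
    (e : Set (Y ⊕ {x : X // x ∉ A}) → Set (Y ⊕ {x : X // x ∉ A}))
    (he : ∀ B, e B = j '' (d (j ⁻¹' B)) ∪ g '' (c (g ⁻¹' B))) :
    (∀ B : Set Y, e (j '' B) = j '' (d B)) ∧
    (∀ B : Set X, B ⊆ Aᶜ → e (g '' B) = g '' (c B)) ∧
    (∀ B : Set (Y ⊕ {x : X // x ∉ A}),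
        e B = j '' (d (j ⁻¹' B)) ∪ g '' (c {x : X | x ∉ A ∧ g x ∈ B})) ∧
    (Function.Injective j ∧ ∀ K : Set Y, d K = K → e (j '' K) = j '' K) := by
  subst hj
  have h₃ : ∀ B : Set (Y ⊕ {x : X // x ∉ A}),
      e B = Sum.inl '' (d (Sum.inl ⁻¹' B)) ∪ g '' (c {x : X | x ∉ A ∧ g x ∈ B}) := by
    intro B
    have hsplit : g ⁻¹' B = (A ∩ g ⁻¹' B) ∪ {x : X | x ∉ A ∧ g x ∈ B} := by
      ext x
      by_cases hx : x ∈ A <;> simp [hx]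
    have hsub : g '' (c (A ∩ g ⁻¹' B)) ⊆ Sum.inl '' (d (Sum.inl ⁻¹' B)) := by
      rintro _ ⟨x, hx, rfl⟩
      have hxA : x ∈ A := hA ▸ hc.mono Set.inter_subset_left hx
      refine ⟨f x, hd.mono ?_ (hf _ Set.inter_subset_left ⟨x, hx, rfl⟩), (hg₁ x hxA).symm⟩
      rintro _ ⟨y, ⟨hyA, hyB⟩, rfl⟩
      simpa [hg₁ y hyA] using hyB
    rw [he, hsplit, hc.2.2, Set.image_union, ← Set.union_assoc,
      Set.union_eq_self_of_subset_right hsub]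
  have h₁ : ∀ B : Set Y, e (Sum.inl '' B) = Sum.inl '' (d B) := by
    intro B
    have hempty : {x : X | x ∉ A ∧ g x ∈ (Sum.inl '' B : Set (Y ⊕ {x : X // x ∉ A}))} = ∅ := by
      ext x
      simp +contextual [hg₂]
    rw [h₃, hempty, hc.1, Set.image_empty, Set.union_empty,
      Set.preimage_image_eq _ Sum.inl_injective]
  refine ⟨h₁, fun B hB => ?_, h₃, Sum.inl_injective, fun K hK => by rw [h₁, hK]⟩
  have hempty : (Sum.inl ⁻¹' (g '' B) : Set Y) = ∅ := by
    ext y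
    simp only [Set.mem_preimage, Set.mem_image, Set.mem_empty_iff_false, iff_false]
    rintro ⟨x, hx, h⟩
    simp [hg₂ x (hB hx)] at h
  have hrestrict : {x : X | x ∉ A ∧ g x ∈ g '' B} = B := by
    ext x
    refine ⟨?_, fun hx => ⟨hB hx, x, hx, rfl⟩⟩
    rintro ⟨hxA, y, hy, h⟩
    rw [hg₂ x hxA, hg₂ y (hB hy)] at h
    simp only [Sum.inr.injEq, Subtype.mk.injEq] at h
    exact h ▸ hy
  rw [h₃, hempty, hd.1, Set.image_empty, Set.empty_union, hrestrict]
end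

section
/- Let X be a compact topological space, let Λ be a pseudotopological convergence structure on a type Y with an interior cover 𝒱, and let f : X → Y be continuous in the sense that for every x ∈ X and every proper filter λ on X with λ ≤ 𝓝 x, one has Λ (Filter.map f λ) (f x). Then there exists a finite open cover 𝒰 of X such that for every U ∈ 𝒰 there is V ∈ 𝒱 with f(U) ⊆ V. -/
/-- A convergence structure on `X`: a relation between (proper) filters and points,
upward closed under refinement of proper filters, with `pure x → x`. -/
def IsConvStruct {X : Type*} (Λ : Filter X → X → Prop) : Prop :=
  (∀ (lam : Filter X) (x : X), Λ lam x →
      ∀ lam' : Filter X, lam'.NeBot → lam' ≤ lam → Λ lam' x) ∧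
  (∀ x : X, Λ (pure x) x)

/-- A convergence structure is pseudotopological if a proper filter converges to `x`
whenever every finer ultrafilter converges to `x`. -/
def IsPseudotop {X : Type*} (Λ : Filter X → X → Prop) : Prop :=
  ∀ lam : Filter X, lam.NeBot → ∀ x : X,
    (∀ γ : Ultrafilter X, (γ : Filter X) ≤ lam → Λ (γ : Filter X) x) → Λ lam x

/-- The adherence operator of a convergence structure:
`a(A) = {x | ∃ proper filter λ with Λ λ x and A ∈ λ}`. -/
def adh {X : Type*} (Λ : Filter X → X → Prop) (A : Set X) : Set X :=
  {x | ∃ lam : Filter X, lam.NeBot ∧ Λ lam x ∧ A ∈ lam}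

/-- The interior operator associated to a closure/adherence operator. -/
def intOp {X : Type*} (c : Set X → Set X) (A : Set X) : Set X := (c Aᶜ)ᶜ

/-- The preimage of a set under a convergence-continuous map is a neighbourhood of every point
sent to its interior. -/
theorem preimage_mem_nhds_of_mem_intOp {X Y : Type*} [TopologicalSpace X]
    {Λ : Filter Y → Y → Prop} {f : X → Y} {x : X} {V : Set Y}
    (hf : ∀ lam : Filter X, lam.NeBot → lam ≤ nhds x → Λ (Filter.map f lam) (f x))
    (hV : f x ∈ intOp (adh Λ) V) : f ⁻¹' V ∈ nhds x := by
  by_contra h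
  have hne : (nhds x ⊓ Filter.principal (f ⁻¹' V)ᶜ).NeBot :=
    ⟨fun hbot => h (Filter.mem_iff_inf_principal_compl.mpr hbot)⟩
  exact hV ⟨_, hne.map f, hf _ hne inf_le_left,
    Filter.mem_inf_of_right (Filter.mem_principal_self _)⟩

/-- If `X` is a compact topological space, `Λ` a pseudotopological convergence
structure on `Y` with interior cover `𝒱`, and `f : X → Y` is continuous (in the
filter-convergence sense), then there is a finite open cover `𝒰` of `X` each of
whose members is mapped by `f` into some member of `𝒱`. -/
theorem exists_finite_open_cover_refining_interiorCover {X Y : Type*}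
    [TopologicalSpace X] [CompactSpace X]
    (Λ : Filter Y → Y → Prop) (hconv : IsConvStruct Λ) (hps : IsPseudotop Λ)
    (𝒱 : Set (Set Y)) (hcov : ⋃ V ∈ 𝒱, intOp (adh Λ) V = Set.univ)
    (f : X → Y)
    (hf : ∀ (x : X) (lam : Filter X), lam.NeBot → lam ≤ nhds x →
        Λ (Filter.map f lam) (f x)) :
    ∃ 𝒰 : Set (Set X), 𝒰.Finite ∧ (∀ U ∈ 𝒰, IsOpen U) ∧ ⋃₀ 𝒰 = Set.univ ∧
      ∀ U ∈ 𝒰, ∃ V ∈ 𝒱, f '' U ⊆ V := by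
  have hV : ∀ x, ∃ V ∈ 𝒱, f x ∈ intOp (adh Λ) V := fun x => by
    simpa using hcov.ge (Set.mem_univ (f x))
  choose V hV𝒱 hfV using hV
  obtain ⟨t, ht⟩ := finite_cover_nhds_interior
    fun x => preimage_mem_nhds_of_mem_intOp (hf x) (hfV x)
  refine ⟨(fun x => interior (f ⁻¹' V x)) '' t, t.finite_toSet.image _, ?_, ?_, ?_⟩
  · rintro _ ⟨x, -, rfl⟩
    exact isOpen_interior
  · simpa [Set.sUnion_image] using ht
  · rintro _ ⟨x, -, rfl⟩
    exact ⟨V x, hV𝒱 x, Set.image_subset_iff.mpr interior_subset⟩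
end

section
/- Let X be a finite type and let Λ be a pseudotopological convergence structure on X. Then for every x ∈ X, the neighborhood filter 𝒰(x) := sSup {λ : Filter X | λ is proper and Λ λ x} (the filter whose members are exactly the sets belonging to every proper filter converging to x) is proper and satisfies Λ (𝒰(x)) x. Hence every finite pseudotopological space is a Čech closure space. -/
/-- On a finite type, a pseudotopological convergence structure is a closure space:
for each `x` the neighborhood filter `𝒰(x) = sSup {λ | λ proper, Λ λ x}` (whose
members are the sets belonging to every proper filter converging to `x`) is proper
and converges to `x`. -/
theorem finite_pseudotop_is_closureSpace {X : Type*} [Finite X]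
    (Λ : Filter X → X → Prop) (hconv : IsConvStruct Λ) (hps : IsPseudotop Λ)
    (x : X) :
    (sSup {lam : Filter X | lam.NeBot ∧ Λ lam x}).NeBot ∧
      Λ (sSup {lam : Filter X | lam.NeBot ∧ Λ lam x}) x := by
  have hne : (sSup {lam : Filter X | lam.NeBot ∧ Λ lam x}).NeBot :=
    Filter.neBot_of_le (f := pure x) (le_sSup ⟨Filter.pure_neBot, hconv.2 x⟩)
  refine ⟨hne, hps _ hne x fun γ hγ => ?_⟩
  obtain ⟨y, rfl⟩ := γ.eq_pure_of_finite
  have hy : {y}ᶜ ∉ sSup {lam : Filter X | lam.NeBot ∧ Λ lam x} := fun h => by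
    simpa using hγ h
  simp only [Filter.mem_sSup, not_forall] at hy
  obtain ⟨lam, ⟨-, hlam⟩, hmem⟩ := hy
  refine hconv.1 lam x hlam _ inferInstance fun s hs => ?_
  by_contra hys
  exact hmem (Filter.mem_of_superset hs fun z hz hzy =>
    hys (Set.mem_singleton_iff.mp hzy ▸ hz))
end
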